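/- Assume α, β, γ are positive irrational numbers with α + β + γ = 1, β < 1/2 and α < γ, and suppose there exist integers r, s ≥ 2 with rα + sβ = 1 and r ≡ s (mod 2). Then W_α and W_β are disjoint, so that W_α, W_β, and C = ℕ \ (W_α ∪ W_β) form a partition of ℕ; moreover, the n-th smallest element c̃(n) of C satisfies c̃(n) − c(n) ∈ {−1, 0, 1} for all n ∈ ℕ, where c(n) = ⌈(n − 1/2)/γ⌉ is the n-th term of the Webster sequence W_γ. -/

import Mathlib

/-- The `n`-th term of the Webster sequence of density `d`: `⌈(n - 1/2)/d⌉`. -/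
noncomputable def wTerm (d : ℝ) (n : ℕ) : ℕ := ⌈((n : ℝ) - 1/2) / d⌉₊

/-- The Webster sequence of density `d`, as a set of positive integers. -/
def wSet (d : ℝ) : Set ℕ := {m : ℕ | ∃ n : ℕ, 1 ≤ n ∧ m = wTerm d n}

/-- The `n`-th smallest element (1-indexed) of a set of naturals. -/
noncomputable def nthElt (S : Set ℕ) (n : ℕ) : ℕ := Nat.nth (· ∈ S) (n - 1)

/-- The number of terms of the Webster sequence of density `d` that are at most `m`. -/
noncomputable def wCount (d : ℝ) (m : ℕ) : ℕ := ⌊d * m + 1/2⌋₊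

lemma wTerm_le_iff {d : ℝ} (hd : 0 < d) (n m : ℕ) : wTerm d n ≤ m ↔ n ≤ wCount d m := by
  unfold wTerm wCount
  rw [Nat.ceil_le, Nat.le_floor_iff (by positivity), div_le_iff₀ hd]
  constructor <;> intro h <;> linarith

lemma wCount_zero (d : ℝ) : wCount d 0 = 0 := by
  unfold wCount
  rw [Nat.floor_eq_zero]
  norm_num

lemma wCount_le {d : ℝ} (hd : 0 < d) (m : ℕ) : (wCount d m : ℝ) ≤ d * m + 1/2 :=
  Nat.floor_le (by positivity)

lemma lt_wCount (d : ℝ) (m : ℕ) : d * m - 1/2 < wCount d m := by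
  have := Nat.lt_floor_add_one (d * m + 1/2)
  unfold wCount
  linarith

lemma wCount_le_succ {d : ℝ} (hd : 0 < d) (m : ℕ) : wCount d m ≤ wCount d (m + 1) := by
  unfold wCount
  gcongr
  simp

lemma wCount_succ_le {d : ℝ} (hd : 0 < d) (hd1 : d < 1) (m : ℕ) :
    wCount d (m + 1) ≤ wCount d m + 1 := by
  have h1 := wCount_le hd (m + 1)
  have h2 := lt_wCount d m
  have h : (wCount d (m + 1) : ℝ) < wCount d m + 2 := by
    push_cast at h1
    linarith
  have : wCount d (m + 1) < wCount d m + 2 := by exact_mod_cast h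
  omega

lemma zero_notMem_wSet {d : ℝ} (hd : 0 < d) : 0 ∉ wSet d := by
  rintro ⟨n, hn, h⟩
  have := (wTerm_le_iff hd n 0).1 h.ge
  rw [wCount_zero] at this
  omega

lemma succ_mem_wSet_iff {d : ℝ} (hd : 0 < d) (m : ℕ) :
    m + 1 ∈ wSet d ↔ wCount d m < wCount d (m + 1) := by
  constructor
  · rintro ⟨n, hn, h⟩
    have h1 := (wTerm_le_iff hd n (m + 1)).1 h.ge
    have h2 := mt (wTerm_le_iff hd n m).2 (by omega)
    omega
  · intro h
    refine ⟨wCount d (m + 1), by omega, ?_⟩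
    have h1 := (wTerm_le_iff hd (wCount d (m + 1)) (m + 1)).2 le_rfl
    have h2 := mt (wTerm_le_iff hd (wCount d (m + 1)) m).1 (by omega)
    omega

lemma disjoint_wSet {α β : ℝ} (hα : 0 < α) (hβ : 0 < β) (hαi : Irrational α)
    {r s : ℕ} (hr : 0 < r) (hrs : (r : ℝ) * α + (s : ℝ) * β = 1) (hpar : r % 2 = s % 2) :
    Disjoint (wSet α) (wSet β) := by
  rw [Set.disjoint_left]
  rintro (_ | m) ha hb
  · exact zero_notMem_wSet hα ha
  rw [succ_mem_wSet_iff hα] at ha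
  rw [succ_mem_wSet_iff hβ] at hb
  have ha1 := wCount_le hα (m + 1)
  have hb1 := wCount_le hβ (m + 1)
  have ha2 : α * m + 1/2 < wCount α (m + 1) := by
    have h : (wCount α m : ℝ) + 1 ≤ wCount α (m + 1) := by exact_mod_cast ha
    linarith [lt_wCount α m]
  have hb2 : β * m + 1/2 < wCount β (m + 1) := by
    have h : (wCount β m : ℝ) + 1 ≤ wCount β (m + 1) := by exact_mod_cast hb
    linarith [lt_wCount β m]
  generalize wCount α (m + 1) = a at *
  generalize wCount β (m + 1) = b at *
  obtain ⟨t, ht⟩ : ∃ t, r + s = 2 * t := ⟨(r + s) / 2, by omega⟩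
  have htR : (r : ℝ) + s = 2 * t := by exact_mod_cast ht
  have hrR : (0 : ℝ) < r := by exact_mod_cast hr
  have hs0 : (0 : ℝ) ≤ s := by positivity
  push_cast at ha1 hb1
  have eA : (r : ℝ) * (α * (m + 1) + 1/2) + s * (β * (m + 1) + 1/2) = m + 1 + t := by
    linear_combination (m + 1 : ℝ) * hrs + htR / 2
  have eB : (r : ℝ) * (α * m + 1/2) + s * (β * m + 1/2) = m + t := by
    linear_combination (m : ℝ) * hrs + htR / 2
  have lower : m + t < r * a + s * b := by
    have : (m : ℝ) + t < r * a + s * b := by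
      rw [← eB]
      exact add_lt_add_of_lt_of_le (mul_lt_mul_of_pos_left ha2 hrR)
        (mul_le_mul_of_nonneg_left hb2.le hs0)
    exact_mod_cast this
  have hlow : (m : ℝ) + 1 + t ≤ r * a + s * b := by
    have : m + 1 + t ≤ r * a + s * b := by omega
    exact_mod_cast this
  have hb3 := mul_le_mul_of_nonneg_left hb1 hs0
  have ha3 : α * (m + 1) + 1/2 ≤ a := le_of_mul_le_mul_left (by linarith) hrR
  refine hαi ⟨((a : ℚ) - 1/2) / (m + 1), ?_⟩
  push_cast
  rw [div_eq_iff (by positivity)]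
  linarith

open scoped Classical in
lemma count_compl_wSet_union {α β : ℝ} (hα : 0 < α) (hβ : 0 < β) (hα1 : α < 1) (hβ1 : β < 1)
    (hdisj : Disjoint (wSet α) (wSet β)) {C : Set ℕ}
    (hC : C = {n : ℕ | 1 ≤ n} \ (wSet α ∪ wSet β)) (m : ℕ) :
    Nat.count (· ∈ C) (m + 1) + wCount α m + wCount β m = m := by
  induction m with
  | zero => simp [hC, Nat.count_succ, wCount_zero]
  | succ m ih =>
    rw [Nat.count_succ]
    have h : m + 1 ∈ wSet α → m + 1 ∉ wSet β := fun h => Set.disjoint_left.1 hdisj h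
    have ha := wCount_le_succ hα m
    have hb := wCount_le_succ hβ m
    have ha' := wCount_succ_le hα hα1 m
    have hb' := wCount_succ_le hβ hβ1 m
    have hmem : m + 1 ∈ C ↔ ¬ (m + 1 ∈ wSet α ∨ m + 1 ∈ wSet β) := by simp [hC]
    simp only [succ_mem_wSet_iff hα, succ_mem_wSet_iff hβ] at h hmem
    split_ifs with hm <;> rw [hmem] at hm <;> omega

open scoped Classical in
lemma nthElt_sub_wTerm_of_count {C : Set ℕ} {γ : ℝ} (hγ : 0 < γ)
    (h1 : ∀ m, wCount γ m ≤ Nat.count (· ∈ C) (m + 2))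
    (h2 : ∀ m, Nat.count (· ∈ C) (m + 1) ≤ wCount γ (m + 1)) {n : ℕ} (hn : 1 ≤ n) :
    nthElt C n ≤ wTerm γ n + 1 ∧ wTerm γ n ≤ nthElt C n + 1 := by
  unfold nthElt
  have hc : n ≤ Nat.count (· ∈ C) (wTerm γ n + 2) :=
    ((wTerm_le_iff hγ n _).1 le_rfl).trans (h1 _)
  constructor
  · have := Nat.nth_lt_of_lt_count (p := (· ∈ C)) (n := wTerm γ n + 2) (k := n - 1) (by omega)
    omega
  · rw [wTerm_le_iff hγ]
    refine le_trans ?_ (h2 _)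
    rw [Nat.count_nth_succ]
    · omega
    · intro hf
      have := Nat.count_le_card hf (wTerm γ n + 2)
      omega

/-- Partition into two exact Webster sequences and one almost Webster sequence,
under the condition `rα + sβ = 1` with `r ≡ s (mod 2)`, `r, s ≥ 2`. -/
theorem two_exact_webster_partition (α β γ : ℝ)
    (hα : 0 < α) (hβ : 0 < β) (hγ : 0 < γ)
    (hαi : Irrational α) (hβi : Irrational β) (hγi : Irrational γ)
    (hsum : α + β + γ = 1) (hβhalf : β < 1/2) (hαγ : α < γ)
    (r s : ℕ) (hr : 2 ≤ r) (hs : 2 ≤ s)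
    (hrs : (r : ℝ) * α + (s : ℝ) * β = 1) (hpar : r % 2 = s % 2) :
    Disjoint (wSet α) (wSet β) ∧
    (∀ C : Set ℕ, C = {n : ℕ | 1 ≤ n} \ (wSet α ∪ wSet β) →
      (Disjoint (wSet α) C ∧ Disjoint (wSet β) C ∧
        wSet α ∪ wSet β ∪ C = {n : ℕ | 1 ≤ n}) ∧
      (∀ n : ℕ, 1 ≤ n →
        ((nthElt C n : ℤ) - (wTerm γ n : ℤ) = -1 ∨
         (nthElt C n : ℤ) - (wTerm γ n : ℤ) = 0 ∨
         (nthElt C n : ℤ) - (wTerm γ n : ℤ) = 1))) := by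
  have hrR : (2 : ℝ) ≤ r := by exact_mod_cast hr
  have hsR : (2 : ℝ) ≤ s := by exact_mod_cast hs
  have hγ2 : 1/2 < γ := by
    refine lt_of_le_of_ne ?_ fun h => hγi ⟨1/2, by push_cast; exact h⟩
    nlinarith [mul_le_mul_of_nonneg_right hrR hα.le, mul_le_mul_of_nonneg_right hsR hβ.le]
  have hdisj := disjoint_wSet hα hβ hαi (by omega) hrs hpar
  refine ⟨hdisj, ?_⟩
  rintro C rfl
  refine ⟨⟨?_, ?_, ?_⟩, fun n hn => ?_⟩
  · exact Set.disjoint_sdiff_right.mono_left Set.subset_union_left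
  · exact Set.disjoint_sdiff_right.mono_left Set.subset_union_right
  · refine Set.union_sdiff_cancel ?_
    rintro m (h | h) <;> refine Nat.one_le_iff_ne_zero.2 ?_ <;> rintro rfl
    · exact zero_notMem_wSet hα h
    · exact zero_notMem_wSet hβ h
  · have hcount := fun m => count_compl_wSet_union hα hβ (by linarith) (by linarith) hdisj rfl m
    have hmul (x : ℝ) : α * x + β * x + γ * x = x := by linear_combination x * hsum
    have key := nthElt_sub_wTerm_of_count (C := {n : ℕ | 1 ≤ n} \ (wSet α ∪ wSet β)) hγ
      (fun m => ?_) (fun m => ?_) hn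
    · omega
    · have h := hcount (m + 1)
      rw [show m + 1 + 1 = m + 2 from rfl] at h
      have hR := congrArg (Nat.cast : ℕ → ℝ) h
      have ha := wCount_le hα (m + 1)
      have hb := wCount_le hβ (m + 1)
      have hc := wCount_le hγ m
      rw [← Nat.lt_add_one_iff, ← Nat.cast_lt (α := ℝ)]
      simp only [Nat.cast_add, Nat.cast_one] at ha hb hR ⊢
      linarith [hmul (m + 1)]
    · have h := hcount m
      have hR := congrArg (Nat.cast : ℕ → ℝ) h
      have ha := lt_wCount α m
      have hb := lt_wCount β m
      have hc := lt_wCount γ (m + 1)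
      rw [← Nat.lt_add_one_iff, ← Nat.cast_lt (α := ℝ)]
      simp only [Nat.cast_add, Nat.cast_one] at hc hR ⊢
      linarith [hmul m]
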